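/- (Convergence of non-intrusive shadowing, deterministic form.) In the hyperbolic linear cocycle setting with C₁ = 1 and bounded inhomogeneity, assume additionally that ‖P⁺_k x‖ ≤ ‖x‖/sin(α) and ‖P⁻_k x‖ ≤ ‖x‖/sin(α) for all k ∈ ℤ, x ∈ ℝ^M, for some α ∈ (0, π/2]. Fix an integer K ≥ 1, let v_k be the shadowing direction, and let v^N be a minimizer of Σ_{k=0}^{K−1} ‖v_k‖² over all finite sequences (v_k)_{0≤k≤K−1} satisfying v_{k+1} = A_k v_k + X_{k+1} for 0 ≤ k ≤ K−2 and P⁻_0 v_0 = 0. Then the error e^N_k := v^N_k − v_k satisfies (1/K) Σ_{k=0}^{K−1} ‖e^N_k‖ ≤ 4χ / (K (1−λ)³ sin α). -/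

import Mathlib

/-- The cocycle `Φ_k^{(n)} := A_{k+n−1} ∘ ⋯ ∘ A_k`, with `Φ_k^{(0)} = id`;
`Φ_k^{(−n)}` is realized as `(Phi A (k−n) n).symm`. -/
noncomputable def Phi {M : ℕ}
    (A : ℤ → EuclideanSpace ℝ (Fin M) ≃L[ℝ] EuclideanSpace ℝ (Fin M)) :
    ℤ → ℕ → (EuclideanSpace ℝ (Fin M) ≃L[ℝ] EuclideanSpace ℝ (Fin M))
  | _, 0 => ContinuousLinearEquiv.refl ℝ _
  | k, (n + 1) => (Phi A k n).trans (A (k + n))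

/-- The shadowing direction
`v_k := Σ_{n≥0} Φ_{k−n}^{(n)} P⁻_{k−n} X_{k−n} − Σ_{n≥1} Φ_{k+n}^{(−n)} P⁺_{k+n} X_{k+n}`. -/
noncomputable def sdir {M : ℕ}
    (A : ℤ → EuclideanSpace ℝ (Fin M) ≃L[ℝ] EuclideanSpace ℝ (Fin M))
    (Pp Pm : ℤ → EuclideanSpace ℝ (Fin M) →L[ℝ] EuclideanSpace ℝ (Fin M))
    (X : ℤ → EuclideanSpace ℝ (Fin M)) (k : ℤ) : EuclideanSpace ℝ (Fin M) :=
  (∑' n : ℕ, Phi A (k - n) n (Pm (k - n) (X (k - n))))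
    - ∑' n : ℕ, (Phi A k (n + 1)).symm (Pp (k + n + 1) (X (k + n + 1)))

/-- The pivot solution
`v^P_k := Σ_{n=0}^{k−1} Φ_{k−n}^{(n)} P⁻_{k−n} X_{k−n} − Σ_{n≥1} Φ_{k+n}^{(−n)} P⁺_{k+n} X_{k+n}`. -/
noncomputable def vpivot {M : ℕ}
    (A : ℤ → EuclideanSpace ℝ (Fin M) ≃L[ℝ] EuclideanSpace ℝ (Fin M))
    (Pp Pm : ℤ → EuclideanSpace ℝ (Fin M) →L[ℝ] EuclideanSpace ℝ (Fin M))
    (X : ℤ → EuclideanSpace ℝ (Fin M)) (k : ℕ) : EuclideanSpace ℝ (Fin M) :=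
  (∑ n ∈ Finset.range k, Phi A ((k : ℤ) - n) n (Pm ((k : ℤ) - n) (X ((k : ℤ) - n))))
    - ∑' n : ℕ, (Phi A (k : ℤ) (n + 1)).symm (Pp ((k : ℤ) + n + 1) (X ((k : ℤ) + n + 1)))

/-- The scalar bound
`v^A_k := Σ_{n≥0} ‖Φ_{k−n}^{(n)} P⁻_{k−n} X_{k−n}‖ + Σ_{n≥1} ‖Φ_{k+n}^{(−n)} P⁺_{k+n} X_{k+n}‖`. -/
noncomputable def vabs {M : ℕ}
    (A : ℤ → EuclideanSpace ℝ (Fin M) ≃L[ℝ] EuclideanSpace ℝ (Fin M))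
    (Pp Pm : ℤ → EuclideanSpace ℝ (Fin M) →L[ℝ] EuclideanSpace ℝ (Fin M))
    (X : ℤ → EuclideanSpace ℝ (Fin M)) (k : ℤ) : ℝ :=
  (∑' n : ℕ, ‖Phi A (k - n) n (Pm (k - n) (X (k - n)))‖)
    + ∑' n : ℕ, ‖(Phi A k (n + 1)).symm (Pp (k + n + 1) (X (k + n + 1)))‖

section Cocycle

variable {M : ℕ} {A : ℤ → EuclideanSpace ℝ (Fin M) ≃L[ℝ] EuclideanSpace ℝ (Fin M)}
  {Pp Pm : ℤ → EuclideanSpace ℝ (Fin M) →L[ℝ] EuclideanSpace ℝ (Fin M)}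
  {X : ℤ → EuclideanSpace ℝ (Fin M)} {lam χ : ℝ}

theorem Phi_zero_apply (k : ℤ) (x : EuclideanSpace ℝ (Fin M)) : Phi A k 0 x = x := rfl

theorem Phi_succ_apply (k : ℤ) (n : ℕ) (x : EuclideanSpace ℝ (Fin M)) :
    Phi A k (n + 1) x = A (k + n) (Phi A k n x) := rfl

theorem Phi_add_apply (k : ℤ) (m n : ℕ) (x : EuclideanSpace ℝ (Fin M)) :
    Phi A k (m + n) x = Phi A (k + m) n (Phi A k m x) := by
  induction n with
  | zero => rfl
  | succ n ih =>
    rw [← add_assoc, Phi_succ_apply, Phi_succ_apply, ih]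
    push_cast
    rw [add_assoc]

theorem apply_Phi_succ_symm (k : ℤ) (n : ℕ) (y : EuclideanSpace ℝ (Fin M)) :
    A k ((Phi A k (n + 1)).symm y) = (Phi A (k + 1) n).symm y := by
  rw [ContinuousLinearEquiv.eq_symm_apply]
  have h := Phi_add_apply (A := A) k 1 n ((Phi A k (n + 1)).symm y)
  rw [add_comm 1 n, ContinuousLinearEquiv.apply_symm_apply, Phi_succ_apply, Phi_zero_apply] at h
  simpa using h.symm

theorem Phi_comp_Pp (hequiv : ∀ k x, A k (Pp k x) = Pp (k + 1) (A k x)) (k : ℤ) (n : ℕ)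
    (x : EuclideanSpace ℝ (Fin M)) : Phi A k n (Pp k x) = Pp (k + n) (Phi A k n x) := by
  induction n with
  | zero => simp [Phi_zero_apply]
  | succ n ih =>
    rw [Phi_succ_apply, Phi_succ_apply, ih, hequiv]
    push_cast
    rw [add_assoc]

/-- The forward (stable) series of the shadowing direction has terms bounded by a geometric
sequence. -/
theorem norm_stable_term_le (hlam0 : 0 < lam)
    (hstab : ∀ (k : ℤ) (n : ℕ) (x), ‖Phi A k n (Pm k x)‖ ≤ lam ^ n * ‖x‖)
    (hχ : ∀ k, ‖X k‖ ≤ χ) (k : ℤ) (n : ℕ) :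
    ‖Phi A (k - n) n (Pm (k - n) (X (k - n)))‖ ≤ χ * lam ^ n := by
  have := hχ (k - n)
  calc _ ≤ lam ^ n * ‖X (k - n)‖ := hstab _ _ _
    _ ≤ lam ^ n * χ := by gcongr
    _ = _ := mul_comm _ _

/-- The backward (unstable) series of the shadowing direction has terms bounded by a geometric
sequence. -/
theorem norm_unstable_term_le (hlam0 : 0 < lam) (hlam1 : lam < 1)
    (hunstab : ∀ (k : ℤ) (n : ℕ) (x), ‖(Phi A (k - n) n).symm (Pp k x)‖ ≤ lam ^ n * ‖x‖)
    (hχ : ∀ k, ‖X k‖ ≤ χ) (k : ℤ) (n : ℕ) :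
    ‖(Phi A k (n + 1)).symm (Pp (k + n + 1) (X (k + n + 1)))‖ ≤ χ * lam ^ n := by
  have h := hunstab (k + n + 1) (n + 1) (X (k + n + 1))
  rw [show k + (n : ℤ) + 1 - ((n + 1 : ℕ) : ℤ) = k by push_cast; ring] at h
  have hX := hχ (k + n + 1)
  calc _ ≤ lam ^ (n + 1) * ‖X (k + n + 1)‖ := h
    _ ≤ lam ^ n * χ := by
      have := pow_le_pow_of_le_one hlam0.le hlam1.le n.le_succ
      gcongr
    _ = _ := mul_comm _ _

theorem summable_of_norm_le_geometric {f : ℕ → EuclideanSpace ℝ (Fin M)} (hlam0 : 0 < lam)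
    (hlam1 : lam < 1) (hf : ∀ n, ‖f n‖ ≤ χ * lam ^ n) : Summable f :=
  .of_norm_bounded ((summable_geometric_of_lt_one hlam0.le hlam1).mul_left χ) hf

theorem norm_tsum_le_geometric {f : ℕ → EuclideanSpace ℝ (Fin M)} (hlam0 : 0 < lam)
    (hlam1 : lam < 1) (hf : ∀ n, ‖f n‖ ≤ χ * lam ^ n) : ‖∑' n, f n‖ ≤ χ / (1 - lam) :=
  tsum_of_norm_bounded
    (by simpa [div_eq_mul_inv] using (hasSum_geometric_of_lt_one hlam0.le hlam1).mul_left χ) hf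

/-- The shadowing direction solves the inhomogeneous tangent equation. -/
theorem sdir_add_one (hsum : ∀ k x, Pp k x + Pm k x = x) (hlam0 : 0 < lam) (hlam1 : lam < 1)
    (hstab : ∀ (k : ℤ) (n : ℕ) (x), ‖Phi A k n (Pm k x)‖ ≤ lam ^ n * ‖x‖)
    (hunstab : ∀ (k : ℤ) (n : ℕ) (x), ‖(Phi A (k - n) n).symm (Pp k x)‖ ≤ lam ^ n * ‖x‖)
    (hχ : ∀ k, ‖X k‖ ≤ χ) (k : ℤ) :
    sdir A Pp Pm X (k + 1) = A k (sdir A Pp Pm X k) + X (k + 1) := by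
  have hS := fun j => summable_of_norm_le_geometric hlam0 hlam1
    (norm_stable_term_le hlam0 hstab hχ j)
  have hU := fun j => summable_of_norm_le_geometric hlam0 hlam1
    (norm_unstable_term_le hlam0 hlam1 hunstab hχ j)
  have hS1 : (∑' n : ℕ, Phi A (k + 1 - n) n (Pm (k + 1 - n) (X (k + 1 - n)))) =
      Pm (k + 1) (X (k + 1)) + A k (∑' n : ℕ, Phi A (k - n) n (Pm (k - n) (X (k - n)))) := by
    rw [(hS (k + 1)).tsum_eq_zero_add, ContinuousLinearEquiv.map_tsum]
    congr 1
    · simp [Phi_zero_apply]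
    · refine tsum_congr fun n => ?_
      rw [Phi_succ_apply]
      rw [show k + 1 - ((n + 1 : ℕ) : ℤ) = k - n by push_cast; ring, sub_add_cancel]
  have hU1 : A k (∑' n : ℕ, (Phi A k (n + 1)).symm (Pp (k + n + 1) (X (k + n + 1)))) =
      Pp (k + 1) (X (k + 1)) + ∑' n : ℕ, (Phi A (k + 1) (n + 1)).symm
        (Pp (k + 1 + n + 1) (X (k + 1 + n + 1))) := by
    rw [(hU k).tsum_eq_zero_add, map_add, apply_Phi_succ_symm, ContinuousLinearEquiv.map_tsum]
    congr 1
    · simp only [Nat.cast_zero, add_zero]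
      rfl
    · refine tsum_congr fun n => ?_
      rw [apply_Phi_succ_symm, show k + ((n + 1 : ℕ) : ℤ) + 1 = k + 1 + n + 1 by push_cast; ring]
  unfold sdir
  rw [map_sub, hS1, hU1]
  have hX := hsum (k + 1) (X (k + 1))
  generalize X (k + 1) = y at hX ⊢
  nth_rewrite 3 [← hX]
  abel

theorem norm_sdir_le (hlam0 : 0 < lam) (hlam1 : lam < 1)
    (hstab : ∀ (k : ℤ) (n : ℕ) (x), ‖Phi A k n (Pm k x)‖ ≤ lam ^ n * ‖x‖)
    (hunstab : ∀ (k : ℤ) (n : ℕ) (x), ‖(Phi A (k - n) n).symm (Pp k x)‖ ≤ lam ^ n * ‖x‖)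
    (hχ : ∀ k, ‖X k‖ ≤ χ) (k : ℤ) :
    ‖sdir A Pp Pm X k‖ ≤ χ / (1 - lam) + χ / (1 - lam) :=
  (norm_sub_le _ _).trans <| add_le_add
    (norm_tsum_le_geometric hlam0 hlam1 (norm_stable_term_le hlam0 hstab hχ k))
    (norm_tsum_le_geometric hlam0 hlam1 (norm_unstable_term_le hlam0 hlam1 hunstab hχ k))

/-- The stable component of the shadowing direction decays geometrically under the cocycle. -/
theorem norm_Phi_Pm_sdir_le (hPp : ∀ k x, Pp k (Pp k x) = Pp k x)
    (hsum : ∀ k x, Pp k x + Pm k x = x)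
    (hequiv : ∀ k x, A k (Pp k x) = Pp (k + 1) (A k x)) (hlam0 : 0 < lam) (hlam1 : lam < 1)
    (hstab : ∀ (k : ℤ) (n : ℕ) (x), ‖Phi A k n (Pm k x)‖ ≤ lam ^ n * ‖x‖)
    (hunstab : ∀ (k : ℤ) (n : ℕ) (x), ‖(Phi A (k - n) n).symm (Pp k x)‖ ≤ lam ^ n * ‖x‖)
    (hχ : ∀ k, ‖X k‖ ≤ χ) (k : ℤ) (n : ℕ) :
    ‖Phi A k n (Pm k (sdir A Pp Pm X k))‖ ≤ lam ^ n * (χ / (1 - lam)) := by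
  have hmp : ∀ j x, Pm j (Pp j x) = 0 := fun j x => by
    have := hsum j (Pp j x)
    rwa [hPp, add_eq_left] at this
  have hU : Pm k (∑' n : ℕ, (Phi A k (n + 1)).symm (Pp (k + n + 1) (X (k + n + 1)))) = 0 := by
    rw [ContinuousLinearMap.map_tsum _ (summable_of_norm_le_geometric hlam0 hlam1
      (norm_unstable_term_le hlam0 hlam1 hunstab hχ k))]
    refine (tsum_congr fun n => ?_).trans tsum_zero
    set y := X (k + n + 1)
    have h : (Phi A k (n + 1)).symm (Pp (k + n + 1) y) =
        Pp k ((Phi A k (n + 1)).symm y) := by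
      rw [ContinuousLinearEquiv.symm_apply_eq, Phi_comp_Pp hequiv,
        ContinuousLinearEquiv.apply_symm_apply]
      push_cast
      rw [add_assoc]
    rw [h, hmp]
  unfold sdir
  rw [map_sub, hU, sub_zero]
  refine (hstab _ _ _).trans ?_
  gcongr
  exact norm_tsum_le_geometric hlam0 hlam1 (norm_stable_term_le hlam0 hstab hχ k)

/-- Orbits in the unstable direction are controlled by their final value. -/
theorem norm_Phi_Pp_le (hPp : ∀ k x, Pp k (Pp k x) = Pp k x)
    (hequiv : ∀ k x, A k (Pp k x) = Pp (k + 1) (A k x))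
    (hunstab : ∀ (k : ℤ) (n : ℕ) (x), ‖(Phi A (k - n) n).symm (Pp k x)‖ ≤ lam ^ n * ‖x‖)
    (k : ℤ) (m n : ℕ) (x : EuclideanSpace ℝ (Fin M)) :
    ‖Phi A k m (Pp k x)‖ ≤ lam ^ n * ‖Phi A k (m + n) (Pp k x)‖ := by
  have h := hunstab (k + (m + n : ℕ)) n (Phi A k (m + n) (Pp k x))
  rw [← Phi_comp_Pp hequiv, hPp, Phi_add_apply,
    show k + ((m + n : ℕ) : ℤ) - n = k + m by push_cast; ring,
    ContinuousLinearEquiv.symm_apply_apply] at h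
  rwa [Phi_add_apply]

end Cocycle

/-- First-order optimality along a line: if `t = 0` minimizes `∑ ‖v k + t • u k‖ ^ 2`, then `v` and
`u` are orthogonal. -/
theorem sum_inner_eq_zero_of_forall_le {ι E : Type*} [NormedAddCommGroup E]
    [InnerProductSpace ℝ E] (s : Finset ι) (v u : ι → E)
    (h : ∀ t : ℝ, ∑ k ∈ s, ‖v k‖ ^ 2 ≤ ∑ k ∈ s, ‖v k + t • u k‖ ^ 2) :
    ∑ k ∈ s, inner ℝ (v k) (u k) = 0 := by
  set b := ∑ k ∈ s, inner ℝ (v k) (u k)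
  set c := ∑ k ∈ s, ‖u k‖ ^ 2
  have hc : 0 ≤ c := Finset.sum_nonneg fun _ _ => sq_nonneg _
  have hq : ∀ t : ℝ, 0 ≤ 2 * t * b + t ^ 2 * c := fun t => by
    have : ∑ k ∈ s, ‖v k + t • u k‖ ^ 2 = ∑ k ∈ s, ‖v k‖ ^ 2 + (2 * t * b + t ^ 2 * c) := by
      simp only [b, c, Finset.mul_sum, ← Finset.sum_add_distrib]
      refine Finset.sum_congr rfl fun k _ => ?_
      rw [norm_add_sq_real, inner_smul_right, norm_smul, mul_pow, Real.norm_eq_abs, sq_abs]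
      ring
    linarith [h t]
  have h1 := hq (-b / (c + 1))
  have h2 : 2 * (-b / (c + 1)) * b + (-b / (c + 1)) ^ 2 * c =
      -(b ^ 2 * (c + 2)) / (c + 1) ^ 2 := by
    field_simp
    ring
  rw [h2, le_div_iff₀ (by positivity), zero_mul] at h1
  have : b ^ 2 = 0 := by nlinarith [sq_nonneg b, mul_nonneg (sq_nonneg b) hc]
  exact pow_eq_zero_iff two_ne_zero |>.1 this

theorem sum_range_pow_le {r : ℝ} (hr0 : 0 < r) (hr1 : r < 1) (n : ℕ) :
    ∑ k ∈ Finset.range n, r ^ k ≤ 1 / (1 - r) := by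
  rw [one_div, ← tsum_geometric_of_lt_one hr0.le hr1]
  exact (summable_geometric_of_lt_one hr0.le hr1).sum_le_tsum _ fun _ _ => by positivity

/-- Convergence of non-intrusive shadowing (deterministic form):
with `C₁ = 1`, projections bounded by `1/sin α`, and `v^N` the minimizer of
`Σ_{k<K} ‖·‖²` over inhomogeneous tangent solutions on `0,…,K−1` with `P⁻_0 v_0 = 0`,
the error `e^N_k := v^N_k − v_k` from the shadowing direction `v` satisfies
`(1/K) Σ_{k<K} ‖e^N_k‖ ≤ 4χ / (K (1−λ)³ sin α)`. -/
theorem stmt11 (M : ℕ) (hM : 0 < M)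
    (A : ℤ → EuclideanSpace ℝ (Fin M) ≃L[ℝ] EuclideanSpace ℝ (Fin M))
    (Pp Pm : ℤ → EuclideanSpace ℝ (Fin M) →L[ℝ] EuclideanSpace ℝ (Fin M))
    (hPp : ∀ k x, Pp k (Pp k x) = Pp k x)
    (hPm : ∀ k x, Pm k (Pm k x) = Pm k x)
    (hsum : ∀ k x, Pp k x + Pm k x = x)
    (hequiv : ∀ k x, A k (Pp k x) = Pp (k + 1) (A k x))
    (lam : ℝ) (hlam0 : 0 < lam) (hlam1 : lam < 1)
    (hstab : ∀ (k : ℤ) (n : ℕ) (x), ‖Phi A k n (Pm k x)‖ ≤ lam ^ n * ‖x‖)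
    (hunstab : ∀ (k : ℤ) (n : ℕ) (x), ‖(Phi A (k - n) n).symm (Pp k x)‖ ≤ lam ^ n * ‖x‖)
    (α : ℝ) (hα0 : 0 < α) (hα1 : α ≤ Real.pi / 2)
    (hPpb : ∀ k x, ‖Pp k x‖ ≤ ‖x‖ / Real.sin α)
    (hPmb : ∀ k x, ‖Pm k x‖ ≤ ‖x‖ / Real.sin α)
    (X : ℤ → EuclideanSpace ℝ (Fin M)) (χ : ℝ) (hχ : ∀ k, ‖X k‖ ≤ χ)
    (K : ℕ) (hK : 1 ≤ K)
    (vN : ℕ → EuclideanSpace ℝ (Fin M))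
    (hfeas1 : ∀ k : ℕ, k + 2 ≤ K → vN (k + 1) = A (k : ℤ) (vN k) + X ((k : ℤ) + 1))
    (hfeas2 : Pm 0 (vN 0) = 0)
    (hmin : ∀ w : ℕ → EuclideanSpace ℝ (Fin M),
      (∀ k : ℕ, k + 2 ≤ K → w (k + 1) = A (k : ℤ) (w k) + X ((k : ℤ) + 1)) →
      Pm 0 (w 0) = 0 →
      (∑ k ∈ Finset.range K, ‖vN k‖ ^ 2) ≤ ∑ k ∈ Finset.range K, ‖w k‖ ^ 2) :
    (1 / (K : ℝ)) * ∑ k ∈ Finset.range K, ‖vN k - sdir A Pp Pm X (k : ℤ)‖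
      ≤ 4 * χ / ((K : ℝ) * (1 - lam) ^ 3 * Real.sin α) := by
  have hχ0 : 0 ≤ χ := (norm_nonneg _).trans (hχ 0)
  have hl : 0 < 1 - lam := by linarith
  have hsin : 0 < Real.sin α := Real.sin_pos_of_pos_of_lt_pi hα0 (by linarith [Real.pi_pos])
  have hKpos : (0 : ℝ) < K := by exact_mod_cast hK
  set v : ℕ → EuclideanSpace ℝ (Fin M) := fun k => sdir A Pp Pm X (k : ℤ) with hv
  set e := vN 0 - v 0 with he
  set u : ℕ → EuclideanSpace ℝ (Fin M) := fun k => Phi A 0 k (Pp 0 e) with hu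
  set m : ℕ → EuclideanSpace ℝ (Fin M) := fun k => Phi A 0 k (Pm 0 e) with hm
  have hsplit : ∀ k < K, vN k - v k = u k + m k := by
    intro k
    induction k with
    | zero => intro _; exact (hsum 0 e).symm
    | succ k ih =>
      intro hk
      have h1 : v (k + 1) = A k (v k) + X (k + 1) := by
        simpa [hv] using sdir_add_one hsum hlam0 hlam1 hstab hunstab hχ (k : ℤ)
      rw [hfeas1 k (by omega), h1, add_sub_add_right_eq_sub, ← map_sub, ih (by omega), map_add]
      simp only [hu, hm, Phi_succ_apply, zero_add]
  have hmle : ∀ k, ‖m k‖ ≤ lam ^ k * (χ / (1 - lam)) := fun k => by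
    have h := norm_Phi_Pm_sdir_le hPp hsum hequiv hlam0 hlam1 hstab hunstab hχ 0 k
    have : Pm 0 e = -Pm 0 (sdir A Pp Pm X 0) := by simp [he, hv, hfeas2]
    simpa only [hm, this, map_neg, norm_neg] using h
  have hmle' : ∀ k, ‖m k‖ ≤ χ / (1 - lam) := fun k =>
    (hmle k).trans (mul_le_of_le_one_left (by positivity) (pow_le_one₀ hlam0.le hlam1.le))
  have hule : ∀ k ∈ Finset.range K, ‖u k‖ ≤ lam ^ (K - 1 - k) * ‖u (K - 1)‖ := fun k hk => by
    have hk := Finset.mem_range.1 hk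
    have h := norm_Phi_Pp_le hPp hequiv hunstab 0 k (K - 1 - k) e
    rwa [show k + (K - 1 - k) = K - 1 by omega] at h
  have husum : ∑ k ∈ Finset.range K, ‖u k‖ ≤ 1 / (1 - lam) * ‖u (K - 1)‖ := by
    refine (Finset.sum_le_sum hule).trans ?_
    rw [← Finset.sum_mul, Finset.sum_range_reflect (fun j => lam ^ j)]
    gcongr
    exact sum_range_pow_le hlam0 hlam1 K
  have horth : ∑ k ∈ Finset.range K, inner ℝ (vN k) (u k) = 0 := by
    refine sum_inner_eq_zero_of_forall_le _ _ _ fun t => hmin (fun k => vN k + t • u k) ?_ ?_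
    · intro k hk
      simp only [hfeas1 k hk, hu, Phi_succ_apply, zero_add, map_add, map_smul]
      abel
    · have h0 : Pm 0 (Pp 0 e) = 0 := by
        have := hsum 0 (Pp 0 e)
        rwa [hPp, add_eq_left] at this
      simp only [hu, Phi_zero_apply, map_add, map_smul, hfeas2, h0, smul_zero, add_zero]
  have hsq : ∑ k ∈ Finset.range K, ‖u k‖ ^ 2 ≤
      3 * (χ / (1 - lam)) * ∑ k ∈ Finset.range K, ‖u k‖ := by
    have hpt : ∀ k ∈ Finset.range K,
        ‖u k‖ ^ 2 ≤ inner ℝ (vN k) (u k) + 3 * (χ / (1 - lam)) * ‖u k‖ := fun k hk => by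
      have hvN : vN k = u k + (v k + m k) := by
        rw [← sub_add_cancel (vN k) (v k), hsplit k (Finset.mem_range.1 hk)]
        abel
      have hb : ‖v k + m k‖ ≤ 3 * (χ / (1 - lam)) := by
        have h1 := norm_sdir_le hlam0 hlam1 hstab hunstab hχ (k : ℤ)
        linarith [norm_add_le (v k) (m k), hmle' k]
      have h1 := neg_le_of_abs_le (abs_real_inner_le_norm (v k + m k) (u k))
      have h2 := mul_le_mul_of_nonneg_right hb (norm_nonneg (u k))
      rw [hvN, inner_add_left, real_inner_self_eq_norm_sq]
      linarith
    have h := Finset.sum_le_sum hpt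
    rwa [Finset.sum_add_distrib, horth, zero_add, ← Finset.mul_sum] at h
  have hlast : ‖u (K - 1)‖ ≤ 3 * (χ / (1 - lam)) * (1 / (1 - lam)) := by
    have h1 : ‖u (K - 1)‖ ^ 2 ≤ ∑ k ∈ Finset.range K, ‖u k‖ ^ 2 :=
      Finset.single_le_sum (f := fun k => ‖u k‖ ^ 2) (fun _ _ => sq_nonneg _)
        (Finset.mem_range.2 (by omega))
    have h2 := mul_le_mul_of_nonneg_left husum (show 0 ≤ 3 * (χ / (1 - lam)) by positivity)
    by_contra! hlt
    have h3 : 0 < ‖u (K - 1)‖ := lt_of_le_of_lt (by positivity) hlt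
    nlinarith
  have hmsum : ∑ k ∈ Finset.range K, ‖m k‖ ≤ 1 / (1 - lam) * (χ / (1 - lam)) := by
    refine (Finset.sum_le_sum fun k _ => hmle k).trans ?_
    rw [← Finset.sum_mul]
    gcongr
    exact sum_range_pow_le hlam0 hlam1 K
  have htotal : ∑ k ∈ Finset.range K, ‖vN k - v k‖ ≤ 4 * χ / (1 - lam) ^ 3 := by
    calc ∑ k ∈ Finset.range K, ‖vN k - v k‖
        ≤ ∑ k ∈ Finset.range K, (‖u k‖ + ‖m k‖) := Finset.sum_le_sum fun k hk => by
          rw [hsplit k (Finset.mem_range.1 hk)]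
          exact norm_add_le _ _
      _ ≤ 1 / (1 - lam) * (3 * (χ / (1 - lam)) * (1 / (1 - lam))) +
          1 / (1 - lam) * (χ / (1 - lam)) := by
        rw [Finset.sum_add_distrib]
        refine add_le_add (husum.trans ?_) hmsum
        gcongr
      _ = (3 * χ + χ * (1 - lam)) / (1 - lam) ^ 3 := by field_simp
      _ ≤ 4 * χ / (1 - lam) ^ 3 := by
        gcongr
        nlinarith
  calc (1 / (K : ℝ)) * ∑ k ∈ Finset.range K, ‖vN k - v k‖
      ≤ 1 / (K : ℝ) * (4 * χ / (1 - lam) ^ 3) := by gcongr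
    _ = 4 * χ / ((K : ℝ) * (1 - lam) ^ 3) := by field_simp
    _ ≤ 4 * χ / ((K : ℝ) * (1 - lam) ^ 3 * Real.sin α) := by
      refine div_le_div_of_nonneg_left (by positivity) (by positivity) ?_
      exact mul_le_of_le_one_right (by positivity) (Real.sin_le_one α)
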